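/- Let g ∈ H(n+1,q) with g ≠ I, and let 1 ≤ k ≤ n+1. The number of k-dimensional subspaces X of F_q^{n+1} with X ⊄ F_q^n and gX = X equals q^{n−k+1}·[n−1 choose k−2]_q. For g = I this number is q^{n−k+1}·[n choose k−1]_q. -/

import Mathlib

/-- The matrix `[[I, a], [0, 1]]` over `F`, indexed by `Fin n ⊕ Unit`. -/
def Hmat {F : Type} [Field F] {n : ℕ} (a : Fin n → F) :
    Matrix (Fin n ⊕ Unit) (Fin n ⊕ Unit) F :=
  Matrix.fromBlocks 1 (Matrix.of fun i (_ : Unit) => a i) 0 1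

/-- The action of the element `[[I, a], [0, 1]]` of `H(n+1, q)` on subspaces of
`F_q^{n+1}`. -/
def actH {F : Type} [Field F] {n : ℕ} (a : Fin n → F)
    (X : Submodule F (Fin n ⊕ Unit → F)) : Submodule F (Fin n ⊕ Unit → F) :=
  Submodule.map (Matrix.mulVecLin (Hmat a)) X

/-- The Gaussian (q-)binomial coefficient, via the q-Pascal recursion. -/
def gaussBinom (q : ℕ) : ℕ → ℕ → ℕ
  | _, 0 => 1
  | 0, _ + 1 => 0
  | n + 1, k + 1 => gaussBinom q n k + q ^ (k + 1) * gaussBinom q n (k + 1)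

/-- The Gaussian binomial coefficient with integer arguments, taken to be `0` when an
argument is negative. -/
def gaussBinomZ (q : ℕ) (n k : ℤ) : ℤ :=
  if 0 ≤ n ∧ 0 ≤ k then gaussBinom q n.toNat k.toNat else 0

theorem gaussBinom_eq_zero_of_lt (q : ℕ) {n k : ℕ} (h : n < k) : gaussBinom q n k = 0 := by
  induction n generalizing k with
  | zero =>
    obtain _ | k := k
    · omega
    · simp [gaussBinom]
  | succ n ih =>
    obtain _ | k := k
    · omega
    · simp [gaussBinom, ih (show n < k by omega), ih (show n < k + 1 by omega)]

theorem gaussBinom_succ_succ (q n k : ℕ) :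
    gaussBinom q (n + 1) (k + 1) = gaussBinom q n k + q ^ (k + 1) * gaussBinom q n (k + 1) :=
  rfl

/-- The second form of the q-Pascal recursion. -/
theorem gaussBinom_succ_succ' (q n k : ℕ) :
    gaussBinom q (n + 1) (k + 1) = gaussBinom q n (k + 1) + q ^ (n - k) * gaussBinom q n k := by
  induction n generalizing k with
  | zero => cases k <;> simp [gaussBinom]
  | succ n ih =>
    obtain _ | k := k
    · have h := ih 0
      simp only [gaussBinom, Nat.sub_zero, mul_one, zero_add, pow_one] at h ⊢
      rw [h, pow_succ]
      linarith
    · have h₁ := ih k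
      have h₂ := ih (k + 1)
      have h₃ := gaussBinom_succ_succ q (n + 1) (k + 1)
      rw [h₁, h₂] at h₃
      rw [h₃, gaussBinom_succ_succ q n (k + 1), gaussBinom_succ_succ q n k,
        show n + 1 - (k + 1) = n - k by omega]
      rcases lt_or_ge k n with hk | hk
      · rw [show n - k = n - (k + 1) + 1 by omega]
        ring
      · rw [gaussBinom_eq_zero_of_lt q (show n < k + 1 by omega)]
        ring

section Counting

variable {F V : Type*} [Field F] [AddCommGroup V] [Module F V]

theorem Submodule.sup_span_singleton_inf_ker (φ : V →ₗ[F] F) {W : Submodule F V}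
    (hW : W ≤ LinearMap.ker φ) {v : V} (hv : φ v = 1) :
    (W ⊔ F ∙ v) ⊓ LinearMap.ker φ = W := by
  refine le_antisymm ?_ (le_inf le_sup_left hW)
  rintro x ⟨hx, hx'⟩
  obtain ⟨w, hw, y, hy, rfl⟩ := Submodule.mem_sup.mp hx
  obtain ⟨c, rfl⟩ := Submodule.mem_span_singleton.mp hy
  have hc : c = 0 := by simpa [LinearMap.mem_ker.mp (hW hw), hv] using hx'
  simpa [hc] using hw

theorem Submodule.exists_mem_apply_eq_one {φ : V →ₗ[F] F} {X : Submodule F V}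
    (hX : ¬ X ≤ LinearMap.ker φ) : ∃ v ∈ X, φ v = 1 := by
  obtain ⟨v, hv, h⟩ := SetLike.not_le_iff_exists.mp hX
  rw [LinearMap.mem_ker] at h
  exact ⟨(φ v)⁻¹ • v, X.smul_mem _ hv, by simp [h]⟩

theorem Submodule.inf_ker_sup_span_singleton (φ : V →ₗ[F] F) {X : Submodule F V} {v : V}
    (hvX : v ∈ X) (hv : φ v = 1) : (X ⊓ LinearMap.ker φ) ⊔ F ∙ v = X := by
  refine le_antisymm (sup_le inf_le_left (by simpa using hvX)) fun x hx => ?_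
  have h : x - φ x • v ∈ X ⊓ LinearMap.ker φ :=
    ⟨X.sub_mem hx (X.smul_mem _ hvX), by simp [hv]⟩
  rw [← sub_add_cancel x (φ x • v)]
  exact Submodule.add_mem_sup h (Submodule.smul_mem _ _ (Submodule.mem_span_singleton_self v))

theorem Submodule.finrank_inf_ker_add_one [FiniteDimensional F V] {φ : V →ₗ[F] F}
    {X : Submodule F V} (hX : ¬ X ≤ LinearMap.ker φ) :
    Module.finrank F ↥(X ⊓ LinearMap.ker φ) + 1 = Module.finrank F X := by
  obtain ⟨v, hvX, hv⟩ := Submodule.exists_mem_apply_eq_one hX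
  have h := (φ.domRestrict X).finrank_range_add_finrank_ker
  have hr : LinearMap.range (φ.domRestrict X) = ⊤ :=
    LinearMap.range_eq_top.mpr fun c => ⟨c • ⟨v, hvX⟩, by simp [hv]⟩
  have hk : (LinearMap.ker (φ.domRestrict X)).map X.subtype = X ⊓ LinearMap.ker φ := by
    ext x
    simp [and_comm]
  have := Submodule.finrank_map_subtype_eq X (LinearMap.ker (φ.domRestrict X))
  rw [hk] at this
  rw [hr, finrank_top, Module.finrank_self] at h
  omega

theorem LinearMap.finrank_ker_add_one [FiniteDimensional F V] {φ : V →ₗ[F] F} (hφ : φ ≠ 0) :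
    Module.finrank F (LinearMap.ker φ) + 1 = Module.finrank F V := by
  have h : ¬ (⊤ : Submodule F V) ≤ LinearMap.ker φ := by
    rwa [top_le_iff, LinearMap.ker_eq_top]
  have htop := Submodule.finrank_inf_ker_add_one h
  rwa [top_inf_eq, finrank_top] at htop

/-- The vectors of `X` on the affine hyperplane `φ = 1` form a torsor under `X ⊓ ker φ`. -/
theorem Submodule.card_apply_eq_one {φ : V →ₗ[F] F} {X : Submodule F V}
    (hX : ¬ X ≤ LinearMap.ker φ) :
    Nat.card {v : V // φ v = 1 ∧ v ∈ X} = Nat.card ↥(X ⊓ LinearMap.ker φ) := by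
  obtain ⟨v, hvX, hv⟩ := Submodule.exists_mem_apply_eq_one hX
  exact Nat.card_congr
    { toFun x := ⟨x.1 - v, X.sub_mem x.2.2 hvX, by simp [x.2.1, hv]⟩
      invFun w := ⟨w.1 + v, by simpa [hv] using w.2.2, X.add_mem w.2.1 hvX⟩
      left_inv x := by simp
      right_inv w := by simp }

/-- The number of subspaces not contained in `ker φ` that meet `ker φ` in a given subspace. -/
theorem Submodule.card_inf_ker_eq [Finite F] [FiniteDimensional F V] {φ : V →ₗ[F] F}
    (hφ : φ ≠ 0) {W : Submodule F V} (hW : W ≤ LinearMap.ker φ) :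
    Nat.card {X : Submodule F V // ¬ X ≤ LinearMap.ker φ ∧ X ⊓ LinearMap.ker φ = W} =
      Nat.card F ^ (Module.finrank F (LinearMap.ker φ) - Module.finrank F W) := by
  have : Finite V := Module.finite_of_finite F
  have hspan (v : V) (hv : φ v = 1) : ¬ (W ⊔ F ∙ v) ≤ LinearMap.ker φ := fun h => by
    have : v ∈ LinearMap.ker φ :=
      h (Submodule.mem_sup_right (Submodule.mem_span_singleton_self v))
    simp [hv] at this
  let e : {v : V // φ v = 1 ∧ v ∈ (⊤ : Submodule F V)} ≃
      Σ X : {X : Submodule F V // ¬ X ≤ LinearMap.ker φ ∧ X ⊓ LinearMap.ker φ = W},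
        {v : V // φ v = 1 ∧ v ∈ X.1} :=
    { toFun v := ⟨⟨W ⊔ F ∙ v.1, hspan _ v.2.1, sup_span_singleton_inf_ker φ hW v.2.1⟩,
        ⟨v.1, v.2.1, Submodule.mem_sup_right (Submodule.mem_span_singleton_self _)⟩⟩
      invFun p := ⟨p.2.1, p.2.2.1, trivial⟩
      left_inv v := rfl
      right_inv := by
        rintro ⟨⟨X, hX, rfl⟩, ⟨v, hv, hvX⟩⟩
        simp only [Sigma.mk.injEq, Subtype.mk.injEq]
        have h := inf_ker_sup_span_singleton φ hvX hv
        refine ⟨h, ?_⟩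
        congr! 3
        rw [h] }
  have htop : ¬ (⊤ : Submodule F V) ≤ LinearMap.ker φ := by
    rwa [top_le_iff, LinearMap.ker_eq_top]
  have hcard := Nat.card_congr e
  have hfib (X : {X : Submodule F V // ¬ X ≤ LinearMap.ker φ ∧ X ⊓ LinearMap.ker φ = W}) :
      Nat.card {v : V // φ v = 1 ∧ v ∈ X.1} = Nat.card W := by
    rw [card_apply_eq_one X.2.1, X.2.2]
  have := Fintype.ofFinite {X : Submodule F V // ¬ X ≤ LinearMap.ker φ ∧ X ⊓ LinearMap.ker φ = W}
  rw [card_apply_eq_one htop, top_inf_eq, Nat.card_sigma,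
    Finset.sum_congr rfl fun X _ => hfib X,
    Finset.sum_const, Finset.card_univ, ← Nat.card_eq_fintype_card, smul_eq_mul,
    Module.natCard_eq_pow_finrank (K := F), Module.natCard_eq_pow_finrank (K := F) (V := W)] at hcard
  have hle := Submodule.finrank_mono hW
  refine Nat.eq_of_mul_eq_mul_right (pow_pos (Nat.card_pos (α := F)) (Module.finrank F W)) ?_
  rw [← hcard, ← pow_add, Nat.sub_add_cancel hle]

/-- Subspaces not contained in `ker φ`, counted through their intersection with `ker φ`. -/
theorem Submodule.card_not_le_ker [Finite F] [FiniteDimensional F V] {φ : V →ₗ[F] F}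
    (hφ : φ ≠ 0) (u : LinearMap.ker φ) (k : ℕ) :
    Nat.card {X : Submodule F V //
        Module.finrank F X = k + 1 ∧ ¬ X ≤ LinearMap.ker φ ∧ (u : V) ∈ X} =
      Nat.card F ^ (Module.finrank F (LinearMap.ker φ) - k) *
        Nat.card {W : Submodule F (LinearMap.ker φ) // Module.finrank F W = k ∧ u ∈ W} := by
  have : Finite V := Module.finite_of_finite F
  let e : {X : Submodule F V //
        Module.finrank F X = k + 1 ∧ ¬ X ≤ LinearMap.ker φ ∧ (u : V) ∈ X} ≃
      Σ W : {W : Submodule F (LinearMap.ker φ) // Module.finrank F W = k ∧ u ∈ W},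
        {X : Submodule F V // ¬ X ≤ LinearMap.ker φ ∧
          X ⊓ LinearMap.ker φ = W.1.map (LinearMap.ker φ).subtype} :=
    { toFun X := ⟨⟨X.1.comap (LinearMap.ker φ).subtype, by
          have h := finrank_inf_ker_add_one X.2.2.1
          rw [inf_comm, ← Submodule.map_comap_subtype, Submodule.finrank_map_subtype_eq, X.2.1] at h
          omega, X.2.2.2⟩,
          ⟨X.1, X.2.2.1, by rw [Submodule.map_comap_subtype, inf_comm]⟩⟩
      invFun p := ⟨p.2.1, by
          rw [← finrank_inf_ker_add_one p.2.2.1, p.2.2.2, Submodule.finrank_map_subtype_eq, p.1.2.1],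
          p.2.2.1, by
          have h : (u : V) ∈ p.1.1.map (LinearMap.ker φ).subtype := ⟨u, p.1.2.2, rfl⟩
          rw [← p.2.2.2] at h
          exact h.1⟩
      left_inv X := rfl
      right_inv := by
        rintro ⟨⟨W, hW⟩, ⟨X, hX, hXW⟩⟩
        obtain rfl : X.comap (LinearMap.ker φ).subtype = W := by
          apply Submodule.map_injective_of_injective (LinearMap.ker φ).injective_subtype
          rw [Submodule.map_comap_subtype, inf_comm, hXW]
        rfl }
  have := Fintype.ofFinite {W : Submodule F (LinearMap.ker φ) // Module.finrank F W = k ∧ u ∈ W}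
  rw [Nat.card_congr e, Nat.card_sigma,
    Finset.sum_congr rfl fun W _ => (card_inf_ker_eq hφ (Submodule.map_subtype_le _ W.1)).trans
      (by rw [Submodule.finrank_map_subtype_eq, W.2.1]),
    Finset.sum_const, Finset.card_univ, ← Nat.card_eq_fintype_card, smul_eq_mul, mul_comm]

theorem Submodule.card_finrank_eq [Finite F] [FiniteDimensional F V] (k : ℕ) :
    Nat.card {X : Submodule F V // Module.finrank F X = k} =
      gaussBinom (Nat.card F) (Module.finrank F V) k := by
  induction hn : Module.finrank F V generalizing V k with
  | zero =>
    have : Subsingleton V := Module.finrank_zero_iff.mp hn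
    obtain _ | k := k
    · have : Unique {X : Submodule F V // Module.finrank F X = 0} :=
        ⟨⟨⊥, by simp⟩, fun X => Subsingleton.elim _ _⟩
      simp [gaussBinom]
    · have : IsEmpty {X : Submodule F V // Module.finrank F X = k + 1} :=
        ⟨fun X => by have := X.2; simp [Module.finrank_zero_of_subsingleton] at this⟩
      simp [gaussBinom]
  | succ n ih =>
    have : Finite V := Module.finite_of_finite F
    obtain _ | k := k
    · have : Unique {X : Submodule F V // Module.finrank F X = 0} :=
        ⟨⟨⊥, by simp⟩, fun X => Subtype.ext (Submodule.finrank_eq_zero.mp X.2)⟩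
      simp [gaussBinom]
    · have : Nontrivial V := Module.nontrivial_of_finrank_pos (R := F) (by omega)
      obtain ⟨φ, hφ⟩ := exists_ne (0 : Module.Dual F V)
      have hker : Module.finrank F (LinearMap.ker φ) = n := by
        have := LinearMap.finrank_ker_add_one hφ
        omega
      have hle : Nat.card {X : Submodule F V //
          Module.finrank F X = k + 1 ∧ X ≤ LinearMap.ker φ} =
          gaussBinom (Nat.card F) n (k + 1) := by
        rw [← ih (k + 1) hker]
        refine (Nat.card_congr ?_).symm
        exact
          { toFun W := ⟨W.1.map (LinearMap.ker φ).subtype, by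
              rw [Submodule.finrank_map_subtype_eq, W.2], Submodule.map_subtype_le _ _⟩
            invFun X := ⟨X.1.comap (LinearMap.ker φ).subtype, by
              rw [← Submodule.finrank_map_subtype_eq, Submodule.map_comap_subtype,
                inf_eq_right.mpr X.2.2, X.2.1]⟩
            left_inv W := Subtype.ext (Submodule.comap_map_eq_of_injective
              (LinearMap.ker φ).injective_subtype _)
            right_inv X := Subtype.ext (by
              simp only [Submodule.map_comap_subtype]
              exact inf_eq_right.mpr X.2.2) }
      have hnle := card_not_le_ker hφ 0 k
      simp only [Submodule.coe_zero, Submodule.zero_mem, and_true, ih k hker, hker] at hnle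
      rw [gaussBinom_succ_succ', ← hle, ← hnle]
      classical
      have := Fintype.ofFinite (Submodule F V)
      simp only [Nat.card_eq_fintype_card, Fintype.card_subtype]
      rw [← Finset.filter_filter, ← Finset.filter_filter, Finset.card_filter_add_card_filter_not]

theorem Submodule.card_finrank_eq_of_mem [Finite F] [FiniteDimensional F V] {u : V}
    (hu : u ≠ 0) (k : ℕ) :
    Nat.card {X : Submodule F V // Module.finrank F X = k + 1 ∧ u ∈ X} =
      gaussBinom (Nat.card F) (Module.finrank F V - 1) k := by
  have hspan : Module.finrank F (F ∙ u) = 1 := finrank_span_singleton hu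
  have hquot := Submodule.finrank_quotient_add_finrank (F ∙ u)
  rw [show Module.finrank F V - 1 = Module.finrank F (V ⧸ F ∙ u) by omega, ← card_finrank_eq]
  have hcomap (Y : Submodule F (V ⧸ F ∙ u)) :
      Module.finrank F (Y.comap (F ∙ u).mkQ) = Module.finrank F Y + 1 := by
    have h := ((F ∙ u).mkQ.domRestrict (Y.comap (F ∙ u).mkQ)).finrank_range_add_finrank_ker
    have hle : F ∙ u ≤ Y.comap (F ∙ u).mkQ := by
      conv_lhs => rw [← Submodule.ker_mkQ (F ∙ u)]
      exact LinearMap.ker_le_comap _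
    rw [LinearMap.range_domRestrict,
      Submodule.map_comap_eq_of_surjective (Submodule.mkQ_surjective _), LinearMap.ker_domRestrict,
      Submodule.ker_mkQ, (Submodule.comapSubtypeEquivOfLe hle).finrank_eq, hspan] at h
    exact h.symm
  refine (Nat.card_congr ?_).symm
  exact
    { toFun Y := ⟨Y.1.comap (F ∙ u).mkQ, by rw [hcomap, Y.2], by
        rw [Submodule.mem_comap, Submodule.mkQ_apply,
          (Submodule.Quotient.mk_eq_zero _).mpr (Submodule.mem_span_singleton_self u)]
        exact Y.1.zero_mem⟩
      invFun X := ⟨X.1.map (F ∙ u).mkQ, by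
        have h := hcomap (X.1.map (F ∙ u).mkQ)
        rw [Submodule.comap_map_mkQ, sup_eq_right.mpr (by simpa using X.2.2), X.2.1] at h
        omega⟩
      left_inv Y := Subtype.ext
        (Submodule.map_comap_eq_of_surjective (Submodule.mkQ_surjective _) _)
      right_inv X := Subtype.ext (by
        simp only [Submodule.comap_map_mkQ]
        exact sup_eq_right.mpr (by simpa using X.2.2)) }

end Counting

theorem Hmat_mulVec {F : Type} [Field F] {n : ℕ} (a : Fin n → F) (x : Fin n ⊕ Unit → F) :
    (Hmat a).mulVecLin x = x + x (Sum.inr ()) • Sum.elim a (0 : Unit → F) := by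
  ext i
  rcases i with i | i
  · simp [Hmat, Matrix.mulVec, dotProduct, Matrix.one_apply, mul_comm]
  · simp [Hmat, Matrix.fromBlocks_mulVec]

/-- A subspace outside the hyperplane is fixed by `[[I, a], [0, 1]]` iff it contains
`(a, 0)`. -/
theorem actH_eq_self_iff {F : Type} [Field F] {n : ℕ} (a : Fin n → F)
    {X : Submodule F (Fin n ⊕ Unit → F)}
    (hX : ¬ X ≤ LinearMap.ker (LinearMap.proj (R := F) (Sum.inr () : Fin n ⊕ Unit))) :
    actH a X = X ↔ Sum.elim a (0 : Unit → F) ∈ X := by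
  constructor
  · intro h
    obtain ⟨v, hvX, hv⟩ := Submodule.exists_mem_apply_eq_one hX
    have hmem : (Hmat a).mulVecLin v ∈ X := h.le ⟨v, hvX, rfl⟩
    rw [Hmat_mulVec, X.add_mem_iff_right hvX] at hmem
    rw [LinearMap.proj_apply] at hv
    rwa [hv, one_smul] at hmem
  · intro h
    apply le_antisymm
    · rintro _ ⟨x, hx, rfl⟩
      rw [Hmat_mulVec]
      exact X.add_mem hx (X.smul_mem _ h)
    · intro x hx
      refine ⟨x - x (Sum.inr ()) • Sum.elim a (0 : Unit → F),
        X.sub_mem hx (X.smul_mem _ h), ?_⟩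
      rw [Hmat_mulVec]
      simp

/-- The number of `k`-dimensional subspaces `X` of `F_q^{n+1}` with `X ⊄ F_q^n` fixed by
`g = [[I, a], [0, 1]] ∈ H(n+1, q)` is `q^{n-k+1} [n-1, k-2]_q` if `g ≠ I` (i.e. `a ≠ 0`),
and `q^{n-k+1} [n, k-1]_q` if `g = I`. -/
theorem card_fixed_subspaces_H (F : Type) [Field F] [Fintype F] (n k : ℕ)
    (hn : 1 ≤ n) (hk1 : 1 ≤ k) (hk2 : k ≤ n + 1)
    (Hyp : Submodule F (Fin n ⊕ Unit → F))
    (hHyp : Hyp = LinearMap.ker (LinearMap.proj (R := F) (Sum.inr () : Fin n ⊕ Unit)))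
    (a : Fin n → F) :
    (a ≠ 0 →
      (Nat.card {X : Submodule F (Fin n ⊕ Unit → F) //
          Module.finrank F ↥X = k ∧ ¬ X ≤ Hyp ∧ actH a X = X} : ℤ) =
        (Fintype.card F : ℤ) ^ (n + 1 - k) *
          gaussBinomZ (Fintype.card F) ((n : ℤ) - 1) ((k : ℤ) - 2)) ∧
    (a = 0 →
      (Nat.card {X : Submodule F (Fin n ⊕ Unit → F) //
          Module.finrank F ↥X = k ∧ ¬ X ≤ Hyp ∧ actH a X = X} : ℤ) =
        (Fintype.card F : ℤ) ^ (n + 1 - k) *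
          gaussBinomZ (Fintype.card F) (n : ℤ) ((k : ℤ) - 1)) := by
  subst hHyp
  obtain ⟨k, rfl⟩ := Nat.exists_eq_add_of_le' hk1
  have hφ : (LinearMap.proj (Sum.inr ()) : (Fin n ⊕ Unit → F) →ₗ[F] F) ≠ 0 := fun h => by
    simpa using LinearMap.congr_fun h 1
  have hker : Module.finrank F (LinearMap.ker
      (LinearMap.proj (Sum.inr ()) : (Fin n ⊕ Unit → F) →ₗ[F] F)) = n := by
    simpa using LinearMap.finrank_ker_add_one hφ
  let u : LinearMap.ker (LinearMap.proj (Sum.inr ()) : (Fin n ⊕ Unit → F) →ₗ[F] F) :=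
    ⟨Sum.elim a 0, by simp⟩
  have hcount := Submodule.card_not_le_ker hφ u k
  rw [hker, Nat.card_eq_fintype_card (α := F)] at hcount
  rw [Nat.card_congr (Equiv.subtypeEquivRight fun X => and_congr_right fun _ =>
    and_congr_right fun hX => actH_eq_self_iff a hX), hcount,
    show n + 1 - (k + 1) = n - k by omega]
  push_cast
  constructor
  · intro ha
    have hu : u ≠ 0 := fun h => ha <| funext fun i =>
      congrFun (congrArg Subtype.val h) (Sum.inl i)
    congr 1
    obtain _ | k := k
    · have : IsEmpty {W : Submodule F (LinearMap.ker
          (LinearMap.proj (Sum.inr ()) : (Fin n ⊕ Unit → F) →ₗ[F] F)) //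
          Module.finrank F W = 0 ∧ u ∈ W} :=
        ⟨fun W => hu (by simpa [Submodule.finrank_eq_zero.mp W.2.1] using W.2.2)⟩
      rw [Nat.card_of_isEmpty]
      simp [gaussBinomZ]
    · rw [Submodule.card_finrank_eq_of_mem hu, hker, gaussBinomZ, if_pos (by omega),
        Nat.card_eq_fintype_card]
      congr 2 <;> omega
  · rintro rfl
    have hu : u = 0 := Subtype.ext (by ext i; cases i <;> rfl)
    simp only [hu, Submodule.zero_mem, and_true]
    rw [Submodule.card_finrank_eq, hker, gaussBinomZ, if_pos (by omega), Nat.card_eq_fintype_card]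
    congr 3
    omega
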